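/- Let G be a countable group, M ⊆ G a finite subset, A a finite set, and S = A^(A^M). Suppose σ_s is stably post-surjective for some s ∈ S^G. Then there exists a finite subset E ⊆ G such that for all g ∈ G and all x, y ∈ A^G with y agreeing with σ_s(x) on G \ {g}, there exists z ∈ A^G such that σ_s(z) = y and z agrees with x on G \ gE, where gE = {gh : h ∈ E}. -/

import Mathlib

open Pointwise

section ANUCA

variable {G : Type*} [Group G] {A : Type*}

/-- The shift action of `G` on configurations: `(g · x) h = x (g⁻¹ * h)`. -/
def shiftC {S : Type*} (g : G) (x : G → S) : G → S := fun h => x (g⁻¹ * h)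

/-- The prodiscrete topology on `G → S` (product topology, `S` discrete). -/
def prodiscrete (G S : Type*) : TopologicalSpace (G → S) :=
  @Pi.topologicalSpace G (fun _ => S) (fun _ => ⊥)

/-- `Σ(s)`: the closure of the shift orbit of `s` in the prodiscrete topology. -/
def orbitClosure {S : Type*} (s : G → S) : Set (G → S) :=
  @closure _ (prodiscrete G S) {p | ∃ g : G, shiftC g s = p}

/-- The ANUCA `σ_s` with memory `M` associated with the configuration of local
defining maps `s : G → (A^M → A)`, namely `σ_s x g = s g ((g⁻¹ · x)|_M)`. -/
def anuca (M : Set G) (s : G → ((M → A) → A)) (x : G → A) : G → A :=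
  fun g => s g (fun m => x (g * (m : G)))

/-- `σ_s` is stably injective if `σ_p` is injective for every `p ∈ Σ(s)`. -/
def StablyInjective (M : Set G) (s : G → ((M → A) → A)) : Prop :=
  ∀ p ∈ orbitClosure s, Function.Injective (anuca M p)

/-- `σ_s` is reversible if `σ_w ∘ σ_s = Id` for some ANUCA `σ_w` with finite memory. -/
def Reversible (M : Set G) (s : G → ((M → A) → A)) : Prop :=
  ∃ N : Set G, N.Finite ∧ ∃ w : G → ((N → A) → A), anuca N w ∘ anuca M s = id

/-- `σ_s` is stably reversible if there are a finite `N ⊆ G` and `q ∈ T^G`,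
`T = A^(A^N)`, such that every `p ∈ Σ(s)` admits `w ∈ Σ(q)` with `σ_w ∘ σ_p = Id`. -/
def StablyReversible (M : Set G) (s : G → ((M → A) → A)) : Prop :=
  ∃ N : Set G, N.Finite ∧ ∃ q : G → ((N → A) → A),
    ∀ p ∈ orbitClosure s, ∃ w ∈ orbitClosure q, anuca N w ∘ anuca M p = id

/-- `σ_s` is invertible if it is bijective and its inverse is an ANUCA with finite memory. -/
def InvertibleANUCA (M : Set G) (s : G → ((M → A) → A)) : Prop :=
  Function.Bijective (anuca M s) ∧
    ∃ N : Set G, N.Finite ∧ ∃ w : G → ((N → A) → A),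
      anuca N w ∘ anuca M s = id ∧ anuca M s ∘ anuca N w = id

/-- Two configurations are asymptotic if they agree outside a finite set. -/
def Asymptotic {S : Type*} (x y : G → S) : Prop := {g : G | x g ≠ y g}.Finite

/-- A map `τ : A^G → A^G` is pre-injective if it is injective on asymptotic pairs. -/
def PreInjective (τ : (G → A) → (G → A)) : Prop :=
  ∀ x y : G → A, Asymptotic x y → τ x = τ y → x = y

/-- A map `τ : A^G → A^G` is post-surjective if every configuration asymptotic to
`τ x` is the image of a configuration asymptotic to `x`. -/
def PostSurjective (τ : (G → A) → (G → A)) : Prop :=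
  ∀ x y : G → A, Asymptotic y (τ x) → ∃ z : G → A, Asymptotic z x ∧ τ z = y

end ANUCA


theorem eventually_forall_mem_apply_eq {G S : Type*} [TopologicalSpace S] [DiscreteTopology S]
    {K : Set G} (hK : K.Finite) (p : G → S) : ∀ᶠ q in nhds p, ∀ h ∈ K, q h = p h := by
  refine (Filter.eventually_all_finite hK).2 fun h _ => ?_
  exact ((continuous_apply h).tendsto p).eventually_mem
    ((isOpen_discrete {p h}).mem_nhds rfl)

section

variable {G A : Type*} [Group G]

theorem shiftC_shiftC_inv {S : Type*} (g : G) (x : G → S) : shiftC g (shiftC g⁻¹ x) = x := by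
  funext h
  simp [shiftC]

/-- ANUCAs are equivariant for the simultaneous shift of local maps and configurations. -/
theorem anuca_shiftC (M : Set G) (s : G → ((M → A) → A)) (x : G → A) (g : G) :
    anuca M (shiftC g s) (shiftC g x) = shiftC g (anuca M s x) := by
  funext h
  simp only [anuca, shiftC, mul_assoc]

/-- A finite correction of `x'` transports to any `(p, x, y)` that coincides with `(p', x', y')`
on a large enough finite set. -/
theorem exists_finite_window (M : Set G) (hM : M.Finite) (p' : G → ((M → A) → A))
    (x' y' z' : G → A) (hz : Asymptotic z' x') (hzy : anuca M p' z' = y') :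
    ∃ K : Set G, K.Finite ∧ ∀ (p : G → ((M → A) → A)) (x y : G → A),
      (∀ h ∈ K, p h = p' h) → (∀ h ∈ K, x h = x' h) → (∀ h ∈ K, y h = y' h) →
      (∀ h : G, h ≠ 1 → y h = anuca M p x h) →
      ∃ z : G → A, anuca M p z = y ∧ ∀ h : G, z' h = x' h → z h = x h := by
  classical
  have hF : {h : G | z' h ≠ x' h}.Finite := hz
  set F := {h : G | z' h ≠ x' h} with hFdef
  set K := F * M⁻¹ ∪ {1} with hK
  have hKf : K.Finite := (hF.mul hM.inv).union (Set.finite_singleton 1)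
  refine ⟨K ∪ K * M, hKf.union (hKf.mul hM), fun p x y hp hx hy hxy =>
    ⟨fun h => if z' h = x' h then x h else z' h, funext fun h => ?_, fun h hh => if_pos hh⟩⟩
  by_cases hh : h ∈ K
  · rw [hy h (.inl hh), ← hzy]
    simp only [anuca]
    rw [hp h (.inl hh)]
    congr 1
    funext m
    split_ifs with hm
    · rw [hx _ (.inr (Set.mul_mem_mul hh m.2)), hm]
    · rfl
  · rw [hxy h fun h1 => hh (.inr h1)]
    simp only [anuca]
    congr 1
    funext m
    refine if_pos (by_contra fun hm => hh (.inl ?_))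
    exact ⟨h * m, hm, (m : G)⁻¹, Set.inv_mem_inv.2 m.2, mul_inv_cancel_right h (m : G)⟩

/-- By compactness of `Σ(s) × A^G × A^G`, one finite set supports all corrections at `1`. -/
theorem exists_uniform_correction_at_one [Finite A] (M : Set G) (hM : M.Finite)
    (s : G → ((M → A) → A)) (hps : ∀ p ∈ orbitClosure s, PostSurjective (anuca M p)) :
    ∃ E : Set G, E.Finite ∧ ∀ p ∈ orbitClosure s, ∀ x y : G → A,
      (∀ h : G, h ≠ 1 → y h = anuca M p x h) →
      ∃ z : G → A, anuca M p z = y ∧ ∀ h : G, h ∉ E → z h = x h := by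
  have := hM.to_subtype
  let : TopologicalSpace A := ⊥
  let : TopologicalSpace ((M → A) → A) := ⊥
  have : DiscreteTopology A := ⟨rfl⟩
  have : DiscreteTopology ((M → A) → A) := ⟨rfl⟩
  have hc : IsCompact (orbitClosure s) := IsClosed.isCompact isClosed_closure
  have hK : IsCompact (orbitClosure s ×ˢ (Set.univ : Set ((G → A) × (G → A)))) :=
    hc.prod isCompact_univ
  have key : ∃ E : Set G, E.Finite ∧
      ∀ q ∈ orbitClosure s ×ˢ (Set.univ : Set ((G → A) × (G → A))),
      (∀ h : G, h ≠ 1 → q.2.2 h = anuca M q.1 q.2.1 h) →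
      ∃ z : G → A, anuca M q.1 z = q.2.2 ∧ ∀ h : G, h ∉ E → z h = q.2.1 h := by
    refine hK.induction_on (p := fun U => ∃ E : Set G, E.Finite ∧ ∀ q ∈ U,
      (∀ h : G, h ≠ 1 → q.2.2 h = anuca M q.1 q.2.1 h) →
      ∃ z : G → A, anuca M q.1 z = q.2.2 ∧ ∀ h : G, h ∉ E → z h = q.2.1 h) ?_ ?_ ?_ ?_
    · exact ⟨∅, Set.finite_empty, fun q hq => hq.elim⟩
    · rintro U V hUV ⟨E, hE, h⟩
      exact ⟨E, hE, fun q hq => h q (hUV hq)⟩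
    · rintro U V ⟨E, hE, hU⟩ ⟨F, hF, hV⟩
      refine ⟨E ∪ F, hE.union hF, ?_⟩
      rintro q (hq | hq) hxy
      · obtain ⟨z, hz, hzx⟩ := hU q hq hxy
        exact ⟨z, hz, fun h hh => hzx h fun h' => hh (.inl h')⟩
      · obtain ⟨z, hz, hzx⟩ := hV q hq hxy
        exact ⟨z, hz, fun h hh => hzx h fun h' => hh (.inr h')⟩
    · rintro ⟨p', x', y'⟩ ⟨hp', -⟩
      have hnear {K : Set G} (hKf : K.Finite) :
          ∀ᶠ q : (G → ((M → A) → A)) × (G → A) × (G → A) in nhds (p', x', y'),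
          (∀ h ∈ K, q.1 h = p' h) ∧ (∀ h ∈ K, q.2.1 h = x' h) ∧ (∀ h ∈ K, q.2.2 h = y' h) := by
        simp only [nhds_prod_eq]
        exact (eventually_forall_mem_apply_eq hKf p').prod_mk
          ((eventually_forall_mem_apply_eq hKf x').prod_mk
            (eventually_forall_mem_apply_eq hKf y'))
      by_cases hxy : ∀ h : G, h ≠ 1 → y' h = anuca M p' x' h
      · obtain ⟨z', hz, hzy⟩ := hps p' hp' x' y' <|
          (Set.finite_singleton (1 : G)).subset fun h hh => by_contra fun h1 => hh (hxy h h1)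
        obtain ⟨K, hKf, hwin⟩ := exists_finite_window M hM p' x' y' z' hz hzy
        refine ⟨_, mem_nhdsWithin_of_mem_nhds (hnear hKf), {h | z' h ≠ x' h}, hz, ?_⟩
        rintro ⟨p, x, y⟩ ⟨hp, hx, hy⟩ hq
        obtain ⟨z, hz1, hz2⟩ := hwin p x y hp hx hy hq
        exact ⟨z, hz1, fun h hh => hz2 h (not_not.1 hh)⟩
      · push Not at hxy
        obtain ⟨h, h1, hne⟩ := hxy
        have hKf : ({h} ∪ {h} * M : Set G).Finite :=
          (Set.finite_singleton h).union ((Set.finite_singleton h).mul hM)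
        refine ⟨_, mem_nhdsWithin_of_mem_nhds (hnear hKf), ∅, Set.finite_empty, ?_⟩
        rintro ⟨p, x, y⟩ ⟨hp, hx, hy⟩ hq
        refine absurd ?_ hne
        rw [← hy h (.inl rfl), hq h h1]
        simp only [anuca]
        rw [show p h = p' h from hp h (.inl rfl)]
        congr 1
        funext m
        exact hx _ (.inr (Set.mul_mem_mul rfl m.2))
  obtain ⟨E, hE, h⟩ := key
  exact ⟨E, hE, fun p hp x y => h (p, x, y) ⟨hp, trivial⟩⟩

end

/-- Uniform post-surjectivity: if `σ_s` is stably post-surjective, then there is a finite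
`E ⊆ G` such that for all `g ∈ G`, whenever `y` agrees with `σ_s(x)` off `{g}`, some `z`
agreeing with `x` off `gE` satisfies `σ_s(z) = y`. -/
theorem stmt19 {G A : Type*} [Group G] [Countable G] [Finite A]
    (M : Set G) (hM : M.Finite) (s : G → ((M → A) → A))
    (hps : ∀ p ∈ orbitClosure s, PostSurjective (anuca M p)) :
    ∃ E : Set G, E.Finite ∧ ∀ (g : G) (x y : G → A),
      (∀ h : G, h ≠ g → y h = anuca M s x h) →
      ∃ z : G → A, anuca M s z = y ∧ ∀ h : G, h ∉ g • E → z h = x h := by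
  obtain ⟨E, hE, hcor⟩ := exists_uniform_correction_at_one M hM s hps
  refine ⟨E, hE, fun g x y hxy => ?_⟩
  have hmem : shiftC g⁻¹ s ∈ orbitClosure s :=
    @subset_closure _ (prodiscrete G ((M → A) → A)) _ _ ⟨g⁻¹, rfl⟩
  obtain ⟨z, hz, hzx⟩ := hcor _ hmem (shiftC g⁻¹ x) (shiftC g⁻¹ y) fun h h1 => by
    rw [anuca_shiftC]
    exact hxy _ (by simpa using h1)
  refine ⟨shiftC g z, ?_, fun h hh => ?_⟩
  · rw [← shiftC_shiftC_inv g s, anuca_shiftC, hz, shiftC_shiftC_inv]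
  · have := hzx (g⁻¹ * h) fun h' => hh (Set.mem_smul_set_iff_inv_smul_mem.2 h')
    simpa [shiftC] using this
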